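/- arXiv:1302.0799 — 3 statements merged into one kernel-verified Lean document; each statement's English description precedes it below -/
import Mathlib

section
/- Let n ≥ 1 and work in the polynomial ring ℂ[c, u₀, u₁, …, u_n, ħ]. For 0 ≤ k ≤ n define S_k := ∏_{i<k}(u_i − c − ħ) · ∏_{i>k}(u_i − c). Then: (i) for every i with k < i ≤ n, substituting c := u_i into S_k gives 0; (ii) substituting c := u_k into S_k gives ∏_{i<k}(u_i − u_k − ħ) · ∏_{i>k}(u_i − u_k); (iii) for every m with 0 ≤ m < k, the polynomial obtained from S_k by substituting c := u_m has total degree at most n − 1 in the variables u₀, …, u_n. These three properties are exactly the defining properties (support, diagonal restriction equal to the Euler class of the attracting normal bundle, and degree bound) characterizing S_k as the stable envelope Stab_C(p_k) of the fixed point p_k in the equivariant cohomology H*_T(T*Pⁿ) = ℂ[c, u₀, …, u_n, ħ]/((c−u₀)⋯(c−u_n)). -/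
open Polynomial MvPolynomial

/-- The ambient coefficient ring `ℂ[u₀, …, u_n, ħ]`: multivariate polynomials in the
equivariant parameters `u₀, …, u_n` (the variables `X i`) with coefficients in `ℂ[ħ]`
(so `ħ = MvPolynomial.C Polynomial.X`).  The Chern class `c` is the variable of an extra
`Polynomial` layer, so the full ring `ℂ[c, u₀, …, u_n, ħ]` is `Polynomial (URing n)`. -/
abbrev URing (n : ℕ) : Type := MvPolynomial (Fin (n + 1)) (Polynomial ℂ)

/-- The equivariant parameter `uᵢ`. -/
noncomputable def uVar (n : ℕ) (i : Fin (n + 1)) : URing n := MvPolynomial.X i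

/-- The parameter `ħ`. -/
noncomputable def hbarVar (n : ℕ) : URing n := MvPolynomial.C Polynomial.X

/-- The stable envelope candidate
`S_k = ∏_{i<k} (uᵢ − c − ħ) · ∏_{i>k} (uᵢ − c)` as a polynomial in `c` over `URing n`. -/
noncomputable def stabP (n : ℕ) (k : Fin (n + 1)) : Polynomial (URing n) :=
  (∏ i ∈ Finset.univ.filter (· < k),
      (Polynomial.C (uVar n i - hbarVar n) - Polynomial.X)) *
  (∏ i ∈ Finset.univ.filter (k < ·),
      (Polynomial.C (uVar n i) - Polynomial.X))

/-- `S_k` satisfies the three defining properties of the stable envelope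
`Stab_C(p_k)` in `H*_T(T*Pⁿ)`:
(i) it vanishes upon the substitution `c := uᵢ` for `i > k` (support condition);
(ii) substituting `c := u_k` gives `∏_{i<k}(uᵢ−u_k−ħ)·∏_{i>k}(uᵢ−u_k)`, the Euler class
of the attracting half of the normal bundle;
(iii) for `m < k` the substitution `c := u_m` has total degree at most `n−1` in the
variables `u₀, …, u_n` (degree condition). -/
theorem instanton_stmt2 (n : ℕ) (hn : 1 ≤ n) (k : Fin (n + 1)) :
    (∀ i : Fin (n + 1), k < i → Polynomial.eval (uVar n i) (stabP n k) = 0) ∧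
    (Polynomial.eval (uVar n k) (stabP n k) =
      (∏ i ∈ Finset.univ.filter (· < k), (uVar n i - uVar n k - hbarVar n)) *
      (∏ i ∈ Finset.univ.filter (k < ·), (uVar n i - uVar n k))) ∧
    (∀ m : Fin (n + 1), m < k →
      (Polynomial.eval (uVar n m) (stabP n k)).totalDegree ≤ n - 1) := by
  have hev : ∀ x : URing n, Polynomial.eval x (stabP n k) =
      (∏ i ∈ Finset.univ.filter (· < k), (uVar n i - x - hbarVar n)) *
      (∏ i ∈ Finset.univ.filter (k < ·), (uVar n i - x)) := by
    intro x
    simp only [stabP, Polynomial.eval_mul, Polynomial.eval_prod, Polynomial.eval_sub,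
      Polynomial.eval_C, Polynomial.eval_X]
    congr 1
    exact Finset.prod_congr rfl fun i _ => by ring
  have hX : ∀ i j : Fin (n + 1), (uVar n i - uVar n j).totalDegree ≤ 1 := by
    intro i j
    refine (MvPolynomial.totalDegree_sub _ _).trans ?_
    simp [uVar, MvPolynomial.totalDegree_X]
  have hC : (hbarVar n).totalDegree = 0 := MvPolynomial.totalDegree_C _
  refine ⟨?_, hev _, ?_⟩
  · intro i hi
    rw [hev]
    refine mul_eq_zero_of_right _ (Finset.prod_eq_zero (i := i) (by simpa using hi) (sub_self _))
  · intro m hm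
    rw [hev]
    have hmem : m ∈ Finset.univ.filter (· < k) := by simpa using hm
    have h1 : (∏ i ∈ Finset.univ.filter (· < k),
        (uVar n i - uVar n m - hbarVar n)).totalDegree ≤ (k : ℕ) - 1 := by
      rw [← Finset.mul_prod_erase _ _ hmem]
      refine (MvPolynomial.totalDegree_mul _ _).trans ?_
      have ha : (uVar n m - uVar n m - hbarVar n).totalDegree = 0 := by
        rw [sub_self, zero_sub, MvPolynomial.totalDegree_neg, hC]
      rw [ha, zero_add]
      refine (MvPolynomial.totalDegree_finset_prod _ _).trans ?_
      refine (Finset.sum_le_card_nsmul _ _ 1 fun i _ => ?_).trans ?_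
      · refine (MvPolynomial.totalDegree_sub _ _).trans ?_
        rw [hC]
        exact max_le (hX i m) (Nat.zero_le _)
      · rw [Finset.card_erase_of_mem hmem, Finset.filter_gt_eq_Iio, Fin.card_Iio]
        simp
    have h2 : (∏ i ∈ Finset.univ.filter (k < ·),
        (uVar n i - uVar n m)).totalDegree ≤ n - (k : ℕ) := by
      refine (MvPolynomial.totalDegree_finset_prod _ _).trans ?_
      refine (Finset.sum_le_card_nsmul _ _ 1 fun i _ => hX i m).trans ?_
      rw [Finset.filter_lt_eq_Ioi, Fin.card_Ioi]
      simp
    refine (MvPolynomial.totalDegree_mul _ _).trans ((add_le_add h1 h2).trans ?_)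
    have := k.isLt
    have : (m : ℕ) < k := hm
    omega
end

section
/- Let F := ℂ[p₁, p₂, p₃, …] be the polynomial ring in countably many variables (the boson Fock space). For n ≥ 1 define the boson operators α₋ₙ ∈ End(F) as multiplication by pₙ and αₙ ∈ End(F) as n·∂/∂pₙ. On F ⊗ F define, for every nonzero integer k, the operator α⁻ₖ := αₖ ⊗ 1 − 1 ⊗ αₖ, and let 𝔥⁻ be the (unital) subalgebra of End(F ⊗ F) generated by all α⁻ₖ, k ∈ ℤ∖{0}. Let ε : F → ℂ be the ℂ-algebra map evaluating every pₙ at 0, and define the vacuum matrix element map Φ : End(F ⊗ F) → End(F) by Φ(A)(x) := (ε ⊗ id)(A(1 ⊗ x)) for x ∈ F. Then Φ restricted to 𝔥⁻ is injective: if A, B ∈ 𝔥⁻ satisfy Φ(A) = Φ(B), then A = B. -/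
open TensorProduct

/-- The boson Fock space `F = ℂ[p₁, p₂, p₃, …]`, realized as multivariate polynomials in
variables `pₙ` indexed by positive integers. -/
abbrev Fock : Type := MvPolynomial ℕ+ ℂ

/-- The annihilation boson `αₙ = n·∂/∂pₙ` for `n ≥ 1`. -/
noncomputable def annOp (n : ℕ+) : Fock →ₗ[ℂ] Fock :=
  ((n : ℕ) : ℂ) • (MvPolynomial.pderiv n).toLinearMap

/-- The creation boson `α₋ₙ`, multiplication by `pₙ`, for `n ≥ 1`. -/
noncomputable def creOp (n : ℕ+) : Fock →ₗ[ℂ] Fock :=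
  LinearMap.mulLeft ℂ (MvPolynomial.X n)

/-- The boson `α_k` for a nonzero integer `k`: for `k > 0` the annihilation operator
`k·∂/∂p_k`, for `k < 0` multiplication by `p₋ₖ` (and junk `0` at `k = 0`). -/
noncomputable def bosonOp (k : ℤ) : Fock →ₗ[ℂ] Fock :=
  if h : 0 < k then annOp ⟨k.toNat, by omega⟩
  else if h' : k < 0 then creOp ⟨(-k).toNat, by omega⟩
  else 0

/-- The difference boson `α⁻ₖ = αₖ ⊗ 1 − 1 ⊗ αₖ` acting on `F ⊗ F`. -/
noncomputable def diffBoson (k : ℤ) : Module.End ℂ (Fock ⊗[ℂ] Fock) :=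
  TensorProduct.map (bosonOp k) LinearMap.id - TensorProduct.map LinearMap.id (bosonOp k)

/-- The Heisenberg algebra `𝔥⁻ ⊂ End(F ⊗ F)` generated by the difference bosons
`α⁻ₖ`, `k ∈ ℤ ∖ {0}`. -/
noncomputable def heisenbergMinus : Subalgebra ℂ (Module.End ℂ (Fock ⊗[ℂ] Fock)) :=
  Algebra.adjoin ℂ {A | ∃ k : ℤ, k ≠ 0 ∧ A = diffBoson k}

/-- The counit `ε : F → ℂ` evaluating every `pₙ` at `0`. -/
noncomputable def vacCounit : Fock →ₐ[ℂ] ℂ :=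
  MvPolynomial.aeval (fun _ : ℕ+ => (0 : ℂ))

/-- The map `ε ⊗ id : F ⊗ F → ℂ ⊗ F ≅ F`. -/
noncomputable def epsTensorId : Fock ⊗[ℂ] Fock →ₗ[ℂ] Fock :=
  (TensorProduct.lid ℂ Fock).toLinearMap ∘ₗ
    TensorProduct.map (vacCounit.toLinearMap) LinearMap.id

/-- The vacuum matrix element map `Φ : End(F ⊗ F) → End(F)`,
`Φ(A)(x) = (ε ⊗ id)(A(1 ⊗ x))`. -/
noncomputable def vacMatrixElem (A : Module.End ℂ (Fock ⊗[ℂ] Fock)) : Module.End ℂ Fock :=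
  epsTensorId ∘ₗ A ∘ₗ TensorProduct.mk ℂ Fock Fock 1


/-- The sum boson. -/
noncomputable def plusOp (a : Fock →ₗ[ℂ] Fock) : Module.End ℂ (Fock ⊗[ℂ] Fock) :=
  TensorProduct.map a LinearMap.id + TensorProduct.map LinearMap.id a

lemma plus_comm_minus (a b : Fock →ₗ[ℂ] Fock) (c : ℂ)
    (h : ∀ x, a (b x) = b (a x) + c • x) :
    Commute (plusOp a)
      (TensorProduct.map b LinearMap.id - TensorProduct.map LinearMap.id b) := by
  apply TensorProduct.ext'
  intro x y
  simp only [plusOp, Module.End.mul_apply, LinearMap.add_apply, LinearMap.sub_apply, map_tmul,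
    LinearMap.id_apply, map_sub, map_add, h, add_tmul, tmul_add, smul_tmul, tmul_smul]
  abel

lemma ann_ann (i j : ℕ+) (x : Fock) : annOp i (annOp j x) = annOp j (annOp i x) + (0 : ℂ) • x := by
  have h : MvPolynomial.pderiv i (MvPolynomial.pderiv j x)
      = MvPolynomial.pderiv j (MvPolynomial.pderiv i x) := by
    ext m
    simp only [MvPolynomial.coeff_pderiv]
    by_cases hij : i = j
    · subst hij; rfl
    · have h1 : j ≠ i := fun h => hij h.symm
      simp [Finsupp.single_apply, hij, h1, add_right_comm]
      ring
  simp [annOp, h, smul_smul, mul_comm]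

lemma cre_cre (i j : ℕ+) (x : Fock) : creOp i (creOp j x) = creOp j (creOp i x) + (0 : ℂ) • x := by
  simp [creOp, mul_left_comm]

lemma ann_cre (i j : ℕ+) : ∃ c : ℂ, ∀ x : Fock,
    annOp i (creOp j x) = creOp j (annOp i x) + c • x := by
  refine ⟨if i = j then ((i : ℕ) : ℂ) else 0, fun x => ?_⟩
  by_cases hij : i = j
  · subst hij
    simp [annOp, creOp, smul_add, add_comm]
  · have h1 : j ≠ i := fun h => hij h.symm
    simp [annOp, creOp, MvPolynomial.pderiv_X_of_ne h1, hij]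

lemma boson_cases (k : ℤ) (hk : k ≠ 0) : (∃ i, bosonOp k = annOp i) ∨ (∃ i, bosonOp k = creOp i) := by
  unfold bosonOp
  by_cases h : 0 < k
  · left; exact ⟨_, dif_pos h⟩
  · right
    have h' : k < 0 := by omega
    exact ⟨_, (dif_neg h).trans (dif_pos h')⟩

lemma comm_of_mem (T A : Module.End ℂ (Fock ⊗[ℂ] Fock)) (hA : A ∈ heisenbergMinus)
    (hT : ∀ k : ℤ, k ≠ 0 → Commute T (diffBoson k)) : Commute T A := by
  unfold heisenbergMinus at hA
  induction hA using Algebra.adjoin_induction with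
  | mem x hx => obtain ⟨k, hk, rfl⟩ := hx; exact hT k hk
  | algebraMap r => exact (Algebra.commutes r T).symm
  | add x y _ _ h1 h2 => exact h1.add_right h2
  | mul x y _ _ h1 h2 => exact h1.mul_right h2

lemma comm_ann (i : ℕ+) (A) (hA : A ∈ heisenbergMinus) : Commute (plusOp (annOp i)) A := by
  refine comm_of_mem _ A hA fun k hk => ?_
  unfold diffBoson
  rcases boson_cases k hk with ⟨j, h⟩ | ⟨j, h⟩ <;> rw [h]
  · exact plus_comm_minus _ _ _ (ann_ann i j)
  · obtain ⟨c, hc⟩ := ann_cre i j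
    exact plus_comm_minus _ _ _ hc

lemma comm_cre (i : ℕ+) (A) (hA : A ∈ heisenbergMinus) : Commute (plusOp (creOp i)) A := by
  refine comm_of_mem _ A hA fun k hk => ?_
  unfold diffBoson
  rcases boson_cases k hk with ⟨j, h⟩ | ⟨j, h⟩ <;> rw [h]
  · obtain ⟨c, hc⟩ := ann_cre j i
    refine plus_comm_minus _ _ (-c) fun x => ?_
    rw [hc]; simp
  · exact plus_comm_minus _ _ _ (cre_cre i j)

/-- Contract the first tensor factor with a functional. -/
noncomputable def contr (g : Fock →ₗ[ℂ] ℂ) : Fock ⊗[ℂ] Fock →ₗ[ℂ] Fock :=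
  (TensorProduct.lid ℂ Fock).toLinearMap ∘ₗ TensorProduct.map g LinearMap.id

lemma contr_plus (g : Fock →ₗ[ℂ] ℂ) (a : Fock →ₗ[ℂ] Fock) (v : Fock ⊗[ℂ] Fock) :
    contr (g ∘ₗ a) v = contr g (plusOp a v) - a (contr g v) := by
  have : contr (g ∘ₗ a) = contr g ∘ₗ plusOp a - a ∘ₗ contr g := by
    apply TensorProduct.ext'
    intro x y
    simp [contr, plusOp]
  rw [this]; rfl

lemma contr_coeff_step (A : Module.End ℂ (Fock ⊗[ℂ] Fock)) (hA : A ∈ heisenbergMinus)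
    (m : ℕ+ →₀ ℕ) (i : ℕ+)
    (h : ∀ x : Fock, contr (MvPolynomial.lcoeff ℂ m) (A (1 ⊗ₜ x)) = 0) :
    ∀ x : Fock, contr (MvPolynomial.lcoeff ℂ (m + Finsupp.single i 1)) (A (1 ⊗ₜ x)) = 0 := by
  intro x
  have h1 := contr_plus (MvPolynomial.lcoeff ℂ m) (annOp i) (A (1 ⊗ₜ x))
  have h2 : plusOp (annOp i) (A (1 ⊗ₜ x)) = A (1 ⊗ₜ (annOp i x)) := by
    have h3 := LinearMap.congr_fun (comm_ann i A hA).eq (1 ⊗ₜ x)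
    simp only [Module.End.mul_apply] at h3
    rw [h3]
    simp [plusOp, annOp]
  rw [h2, h, h, map_zero, sub_zero] at h1
  have h4 : (MvPolynomial.lcoeff ℂ m) ∘ₗ annOp i
      = (((i : ℕ) : ℂ) * ((m i : ℂ) + 1)) • MvPolynomial.lcoeff ℂ (m + Finsupp.single i 1) := by
    ext1 f
    apply LinearMap.ext
    intro y
    simp [annOp, MvPolynomial.lcoeff, MvPolynomial.coeff_pderiv]
    ring
  rw [h4] at h1
  simp only [contr, TensorProduct.map_smul_left, LinearMap.comp_smul, LinearMap.smul_apply] at h1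
  refine (smul_eq_zero.mp h1).resolve_left (mul_ne_zero ?_ ?_)
  · exact_mod_cast i.ne_zero
  · exact_mod_cast Nat.succ_ne_zero (m i)

lemma contr_coeff_add (A : Module.End ℂ (Fock ⊗[ℂ] Fock)) (hA : A ∈ heisenbergMinus)
    (m : ℕ+ →₀ ℕ) : ∀ m0 : ℕ+ →₀ ℕ,
    (∀ x : Fock, contr (MvPolynomial.lcoeff ℂ m0) (A (1 ⊗ₜ x)) = 0) →
    ∀ x : Fock, contr (MvPolynomial.lcoeff ℂ (m0 + m)) (A (1 ⊗ₜ x)) = 0 := by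
  induction m using Finsupp.induction_linear with
  | zero => intro m0 h; simpa using h
  | add f g hf hg =>
    intro m0 h
    rw [← add_assoc]
    exact hg _ (hf _ h)
  | single i n =>
    intro m0 h
    induction n with
    | zero => simpa using h
    | succ n ih =>
      rw [Finsupp.single_add, ← add_assoc]
      exact contr_coeff_step A hA _ i ih

lemma contr_coeff_zero (A : Module.End ℂ (Fock ⊗[ℂ] Fock)) (hA : A ∈ heisenbergMinus)
    (h : vacMatrixElem A = 0) (m : ℕ+ →₀ ℕ) :
    ∀ x : Fock, contr (MvPolynomial.lcoeff ℂ m) (A (1 ⊗ₜ x)) = 0 := by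
  have h0 := contr_coeff_add A hA m 0
  rw [zero_add] at h0
  apply h0
  intro x
  have h1 : MvPolynomial.lcoeff ℂ (0 : ℕ+ →₀ ℕ) = vacCounit.toLinearMap := by
    apply LinearMap.ext
    intro y
    simp [MvPolynomial.lcoeff, vacCounit, MvPolynomial.constantCoeff_eq]
  rw [h1]
  exact LinearMap.congr_fun h x

lemma eq_zero_of_contr (v : Fock ⊗[ℂ] Fock)
    (h : ∀ m, contr (MvPolynomial.lcoeff ℂ m) v = 0) : v = 0 := by
  classical
  apply (TensorProduct.equivFinsuppOfBasisLeft (N := Fock)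
    (MvPolynomial.basisMonomials ℕ+ ℂ)).injective
  rw [map_zero]
  apply Finsupp.ext
  intro m
  rw [Finsupp.zero_apply, ← h m, TensorProduct.equivFinsuppOfBasisLeft_apply]
  rfl

/-- the vacuum matrix element map `Φ` is injective on the Heisenberg algebra
`𝔥⁻`: an element of `𝔥⁻` is uniquely determined by its vacuum matrix element. -/
theorem instanton_stmt6 (A B : Module.End ℂ (Fock ⊗[ℂ] Fock))
    (hA : A ∈ heisenbergMinus) (hB : B ∈ heisenbergMinus)
    (h : vacMatrixElem A = vacMatrixElem B) : A = B := by
  rw [← sub_eq_zero]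
  have hC : A - B ∈ heisenbergMinus := by
    have e : A - B = A + (-1 : ℂ) • B := by
      apply LinearMap.ext
      intro v
      rw [LinearMap.sub_apply, LinearMap.add_apply, LinearMap.smul_apply, neg_one_smul,
        sub_eq_add_neg]
    rw [e]
    exact Subalgebra.add_mem _ hA (Subalgebra.smul_mem _ hB _)
  have h0 : vacMatrixElem (A - B) = 0 := by
    have : vacMatrixElem (A - B) = vacMatrixElem A - vacMatrixElem B := by
      apply LinearMap.ext; intro y; simp [vacMatrixElem]
    rw [this, h, sub_self]
  generalize A - B = C at hC h0
  have h1 : ∀ x : Fock, C (1 ⊗ₜ x) = 0 := fun x =>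
    eq_zero_of_contr _ fun m => contr_coeff_zero C hC h0 m x
  apply TensorProduct.ext'
  intro f x
  rw [LinearMap.zero_apply]
  induction f using MvPolynomial.induction_on generalizing x with
  | C a => rw [← mul_one (MvPolynomial.C a), ← MvPolynomial.smul_eq_C_mul, ← smul_tmul', map_smul, h1, smul_zero]
  | add p q hp hq => rw [add_tmul, map_add, hp, hq, add_zero]
  | mul_X p i hp =>
    have h2 := LinearMap.congr_fun (comm_cre i C hC).eq (p ⊗ₜ x)
    simp only [Module.End.mul_apply, hp, map_zero, plusOp, LinearMap.add_apply, map_tmul,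
      LinearMap.id_apply, map_add, add_zero] at h2
    rw [mul_comm]
    exact h2.symm
end

section
/- Let V be a finite-dimensional ℂ-vector space, n₁, n₂ ≥ 1, N := n₁ + n₂, and ħ ∈ ℂ. On V^{⊗N} let P_{ab} denote the transposition of tensor factors a and b, and for a spectral parameter s set R_{ab}(s) := s·id + ħ·P_{ab}. Define the fused operator F(u) := ∏_{m=0}^{n₁−1} ∏_{k=1}^{n₂} R_{n₁−m, n₁+k}(u + (m+k−1)ħ), where the product is ordered from right to left in the index (m, k) ordered lexicographically (m outer, k inner): the rightmost factor is R_{n₁, n₁+1}(u) (m = 0, k = 1), within each fixed m the index k increases from right to left, and the blocks with larger m stand further to the left; e.g. for n₁ = 2, n₂ = 3: F(u) = R_{15}(u+3ħ)·R_{14}(u+2ħ)·R_{13}(u+ħ)·R_{25}(u+2ħ)·R_{24}(u+ħ)·R_{23}(u). Let W ⊂ V^{⊗N} be the subspace of tensors that are antisymmetric under all permutations of the first n₁ tensor factors and antisymmetric under all permutations of the last n₂ tensor factors (so W ≅ Λ^{n₁}V ⊗ Λ^{n₂}V). Then for every u ∈ ℂ, F(u) maps W into itself. -/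
open TensorProduct PiTensorProduct

noncomputable section

variable (n₁ n₂ : ℕ) {V : Type*} [AddCommGroup V] [Module ℂ V]

/-- The `N = n₁ + n₂`-fold tensor power `V^{⊗N}`. -/
abbrev TPow (n₁ n₂ : ℕ) (V : Type*) [AddCommGroup V] [Module ℂ V] : Type _ :=
  PiTensorProduct ℂ (fun _ : Fin (n₁ + n₂) => V)

/-- The action of a permutation `σ` of the `N` tensor slots on `V^{⊗N}`. -/
def permEnd (σ : Equiv.Perm (Fin (n₁ + n₂))) : Module.End ℂ (TPow n₁ n₂ V) :=
  (PiTensorProduct.reindex ℂ (fun _ : Fin (n₁ + n₂) => V) σ).toLinearMap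

/-- The elementary rational R-matrix `R_{ab}(s) = s·id + ħ·P_{ab}` acting in tensor
slots `a` and `b` of `V^{⊗N}` (slots given as elements of `Fin N`, 0-based). -/
def Rab (hbar : ℂ) (a b : Fin (n₁ + n₂)) (s : ℂ) : Module.End ℂ (TPow n₁ n₂ V) :=
  s • 1 + hbar • permEnd n₁ n₂ (Equiv.swap a b)

/-- The list of index pairs `(m, k')`, `0 ≤ m < n₁`, `0 ≤ k' < n₂` (so `k = k' + 1`),
in increasing lexicographic order (`m` outer, `k` inner). -/
def fusePairs : List (Fin n₁ × Fin n₂) :=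
  (List.finRange n₁).flatMap fun m => (List.finRange n₂).map fun k => (m, k)

/-- The (0-based) slot `n₁ − m` (1-based), i.e. `n₁ − m − 1`. -/
def slotA (m : Fin n₁) : Fin (n₁ + n₂) := ⟨n₁ - 1 - m.1, by have := m.isLt; omega⟩

/-- The (0-based) slot `n₁ + k` (1-based) with `k = k' + 1`, i.e. `n₁ + k'`. -/
def slotB (k : Fin n₂) : Fin (n₁ + n₂) := ⟨n₁ + k.1, by have := k.isLt; omega⟩

/-- The fused operator
`F(u) = ∏_{m=0}^{n₁−1} ∏_{k=1}^{n₂} R_{n₁−m, n₁+k}(u + (m+k−1)ħ)`,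
ordered right-to-left in lexicographically increasing `(m, k)`: the rightmost factor is
`R_{n₁, n₁+1}(u)`, within each block `k` increases from right to left, and blocks with
larger `m` stand further to the left. -/
def fusedF (hbar u : ℂ) : Module.End ℂ (TPow n₁ n₂ V) :=
  (((fusePairs n₁ n₂).map fun p =>
      Rab n₁ n₂ hbar (slotA n₁ n₂ p.1) (slotB n₁ n₂ p.2)
        (u + ((p.1.1 + p.2.1 : ℕ) : ℂ) * hbar)).reverse).prod

/-- The subspace `W ≅ Λ^{n₁}V ⊗ Λ^{n₂}V ⊂ V^{⊗N}`: tensors antisymmetric under every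
permutation of the first `n₁` slots (those fixing all slots with index `≥ n₁`) and
antisymmetric under every permutation of the last `n₂` slots (those fixing all slots
with index `< n₁`). -/
def IsBiAntisym (w : TPow n₁ n₂ V) : Prop :=
  (∀ σ : Equiv.Perm (Fin (n₁ + n₂)), (∀ i : Fin (n₁ + n₂), n₁ ≤ (i : ℕ) → σ i = i) →
      permEnd n₁ n₂ σ w = (Equiv.Perm.sign σ : ℤ) • w) ∧
  (∀ σ : Equiv.Perm (Fin (n₁ + n₂)), (∀ i : Fin (n₁ + n₂), (i : ℕ) < n₁ → σ i = i) →
      permEnd n₁ n₂ σ w = (Equiv.Perm.sign σ : ℤ) • w)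

end

section Helpers

variable {A : Type*} [Ring A]

/-- Elements that can be moved through `S` from right to left. -/
def passH (S : A) : Submonoid A where
  carrier := {X | ∃ X', S * X = X' * S}
  one_mem' := ⟨1, by simp⟩
  mul_mem' := by
    rintro X Y ⟨X', hX⟩ ⟨Y', hY⟩
    exact ⟨X' * Y', by rw [← mul_assoc, hX, mul_assoc, hY, mul_assoc]⟩

/-- right-to-left ordered product -/
def rprod (f : ℕ → A) : ℕ → A
  | 0 => 1
  | n + 1 => f n * rprod f n

lemma rprod_mem (H : Submonoid A) (f : ℕ → A) (n : ℕ) (h : ∀ j < n, f j ∈ H) :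
    rprod f n ∈ H := by
  induction n with
  | zero => exact H.one_mem
  | succ n ih => exact H.mul_mem (h n (by omega)) (ih fun j hj => h j (by omega))

lemma rprod_mem_pair (H : Submonoid A) (f : ℕ → A) (k n : ℕ) (hk : k + 1 < n)
    (h : ∀ j < n, j ≠ k → j ≠ k + 1 → f j ∈ H) (hp : f (k + 1) * f k ∈ H) :
    rprod f n ∈ H := by
  induction n with
  | zero => omega
  | succ n ih =>
    by_cases hn : k + 1 = n
    · subst hn
      change f (k + 1) * (f k * rprod f k) ∈ H
      rw [← mul_assoc]
      exact H.mul_mem hp (rprod_mem H f k fun j hj => h j (by omega) (by omega) (by omega))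
    · exact H.mul_mem (h n (by omega) (by omega) (by omega))
        (ih (by omega) fun j hj => h j (by omega))

lemma rprod_commute (f : ℕ → A) (n : ℕ) (x : A) (h : ∀ j < n, Commute x (f j)) :
    Commute x (rprod f n) := by
  induction n with
  | zero => exact Commute.one_right x
  | succ n ih => exact (h n (by omega)).mul_right (ih fun j hj => h j (by omega))

lemma rprod_mul (f g : ℕ → A) (n : ℕ) (h : ∀ i < n, ∀ j < n, i ≠ j → Commute (g i) (f j)) :
    rprod f n * rprod g n = rprod (fun i => f i * g i) n := by
  induction n with
  | zero => simp [rprod]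
  | succ n ih =>
    have hc : Commute (g n) (rprod f n) :=
      rprod_commute f n _ fun j hj => h n (by omega) j (by omega) (by omega)
    have := ih fun i hi j hj => h i (by omega) j (by omega)
    simp only [rprod]
    rw [← this]
    calc f n * rprod f n * (g n * rprod g n) = f n * (rprod f n * g n) * rprod g n := by
          noncomm_ring
      _ = f n * (g n * rprod f n) * rprod g n := by rw [hc.eq]
      _ = _ := by noncomm_ring

lemma finRange_rprod (n : ℕ) (f : Fin n → A) (g : ℕ → A) (h : ∀ i : Fin n, f i = g i) :
    (((List.finRange n).map f).reverse).prod = rprod g n := by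
  induction n with
  | zero => simp [rprod]
  | succ n ih =>
    rw [List.finRange_succ_last]
    simp only [List.map_append, List.map_map, List.reverse_append, List.prod_append]
    rw [ih (f ∘ Fin.castSucc) (fun i => by simp [h])]
    simp [rprod, h]

lemma flatMap_prod {ι κ : Type*} (l : List ι) (t : ι → List κ) (φ : κ → A) :
    (((l.flatMap t).map φ).reverse).prod
      = ((l.map fun m => (((t m).map φ).reverse).prod).reverse).prod := by
  induction l with
  | nil => simp
  | cons a l ih => simp [ih]

end Helpers

section Perm

variable (n₁ n₂ : ℕ) {V : Type*} [AddCommGroup V] [Module ℂ V]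

lemma permEnd_mul (σ τ : Equiv.Perm (Fin (n₁ + n₂))) :
    (permEnd n₁ n₂ (σ * τ) : Module.End ℂ (TPow n₁ n₂ V))
      = permEnd n₁ n₂ σ * permEnd n₁ n₂ τ := by
  ext x
  simp [permEnd, PiTensorProduct.reindex_tprod]
  rfl

lemma permEnd_one : (permEnd n₁ n₂ 1 : Module.End ℂ (TPow n₁ n₂ V)) = 1 := by
  ext x
  simp [permEnd, PiTensorProduct.reindex_tprod]
  rfl

lemma Rab_comm (hbar s : ℂ) (a b : Fin (n₁ + n₂)) :
    (Rab n₁ n₂ hbar a b s : Module.End ℂ (TPow n₁ n₂ V)) = Rab n₁ n₂ hbar b a s := by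
  simp [Rab, Equiv.swap_comm]

lemma swap_comm_disj {α : Type*} [DecidableEq α] (a b c d : α) (h1 : a ≠ c) (h2 : a ≠ d)
    (h3 : b ≠ c) (h4 : b ≠ d) :
    Equiv.swap a b * Equiv.swap c d = Equiv.swap c d * Equiv.swap a b := by
  ext x
  simp only [Equiv.Perm.mul_apply, Equiv.swap_apply_def]
  grind

lemma permEnd_commute (a b c d : Fin (n₁ + n₂)) (h1 : a ≠ c) (h2 : a ≠ d)
    (h3 : b ≠ c) (h4 : b ≠ d) :
    Commute (permEnd n₁ n₂ (Equiv.swap a b) : Module.End ℂ (TPow n₁ n₂ V))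
      (permEnd n₁ n₂ (Equiv.swap c d)) := by
  unfold Commute SemiconjBy
  rw [← permEnd_mul, ← permEnd_mul, swap_comm_disj a b c d h1 h2 h3 h4]

lemma permEnd_Rab_commute (hbar s : ℂ) (a b c d : Fin (n₁ + n₂)) (h1 : a ≠ c) (h2 : a ≠ d)
    (h3 : b ≠ c) (h4 : b ≠ d) :
    Commute (permEnd n₁ n₂ (Equiv.swap a b) : Module.End ℂ (TPow n₁ n₂ V))
      (Rab n₁ n₂ hbar c d s) :=
  ((Commute.one_right _).smul_right s).add_right
    ((permEnd_commute n₁ n₂ a b c d h1 h2 h3 h4).smul_right hbar)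

lemma Rab_commute (hbar s t : ℂ) (a b c d : Fin (n₁ + n₂)) (h1 : a ≠ c) (h2 : a ≠ d)
    (h3 : b ≠ c) (h4 : b ≠ d) :
    Commute (Rab n₁ n₂ hbar a b t : Module.End ℂ (TPow n₁ n₂ V))
      (Rab n₁ n₂ hbar c d s) :=
  ((Commute.one_left _).smul_left t).add_left
    ((permEnd_Rab_commute n₁ n₂ hbar s a b c d h1 h2 h3 h4).smul_left hbar)

/-- symmetrizer -/
def symS (a b : Fin (n₁ + n₂)) : Module.End ℂ (TPow n₁ n₂ V) :=
  1 + permEnd n₁ n₂ (Equiv.swap a b)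

lemma Rab_mem (hbar s : ℂ) (a b c d : Fin (n₁ + n₂)) (h1 : a ≠ c) (h2 : a ≠ d)
    (h3 : b ≠ c) (h4 : b ≠ d) :
    (Rab n₁ n₂ hbar c d s : Module.End ℂ (TPow n₁ n₂ V)) ∈ passH (symS n₁ n₂ a b) :=
  ⟨_, ((Commute.one_left _).add_left
    (permEnd_Rab_commute n₁ n₂ hbar s a b c d h1 h2 h3 h4)).eq⟩

lemma Rab_pair (hbar s : ℂ) (a b c : Fin (n₁ + n₂)) (hab : a ≠ b) (hac : a ≠ c) (hbc : b ≠ c) :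
    (Rab n₁ n₂ hbar a c (s + hbar) * Rab n₁ n₂ hbar a b s : Module.End ℂ (TPow n₁ n₂ V))
      ∈ passH (symS n₁ n₂ b c) := by
  refine ⟨Rab n₁ n₂ hbar a b s * Rab n₁ n₂ hbar a c (s + hbar), ?_⟩
  have e1 : Equiv.swap b c * Equiv.swap a c = Equiv.swap a c * Equiv.swap a b := by
    ext x; simp only [Equiv.Perm.mul_apply, Equiv.swap_apply_def]; grind
  have e2 : Equiv.swap a b * Equiv.swap b c = Equiv.swap a c * Equiv.swap a b := by
    ext x; simp only [Equiv.Perm.mul_apply, Equiv.swap_apply_def]; grind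
  have e3 : Equiv.swap a c * Equiv.swap b c = Equiv.swap a b * Equiv.swap a c := by
    ext x; simp only [Equiv.Perm.mul_apply, Equiv.swap_apply_def]; grind
  have e4 : Equiv.swap b c * Equiv.swap a b = Equiv.swap a b * Equiv.swap a c := by
    ext x; simp only [Equiv.Perm.mul_apply, Equiv.swap_apply_def]; grind
  have e5 : Equiv.swap b c * (Equiv.swap a c * Equiv.swap a b) = Equiv.swap a c := by
    rw [← e1, ← mul_assoc, Equiv.swap_mul_self, one_mul]
  have e6 : Equiv.swap a b * (Equiv.swap a b * Equiv.swap a c) = Equiv.swap a c := by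
    rw [← mul_assoc, Equiv.swap_mul_self, one_mul]
  have f := fun {σ τ} => permEnd_mul (V := V) n₁ n₂ σ τ
  simp only [symS, Rab, add_mul, mul_add, smul_mul_assoc, mul_smul_comm, one_mul, mul_one,
    mul_assoc]
  simp only [← f, e1, e2, e3, e4, e5, e6]
  module

/-- The subspace condition for a fixed permutation. -/
def anti (x : TPow n₁ n₂ V) : Submonoid (Equiv.Perm (Fin (n₁ + n₂))) where
  carrier := {σ | permEnd n₁ n₂ σ x = (Equiv.Perm.sign σ : ℤ) • x}
  one_mem' := by simp [permEnd_one]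
  mul_mem' := by
    intro σ τ hσ hτ
    simp only [Set.mem_ofPred_eq] at *
    rw [permEnd_mul, Module.End.mul_apply, hτ, map_zsmul, hσ, smul_smul]
    simp [mul_comm]

lemma swap_mem_anti (x : TPow n₁ n₂ V) (a b : Fin (n₁ + n₂)) (hab : a ≠ b) :
    Equiv.swap a b ∈ anti n₁ n₂ x ↔ symS n₁ n₂ a b x = 0 := by
  change permEnd n₁ n₂ _ x = _ ↔ _
  simp [symS, Equiv.Perm.sign_swap hab, add_comm x, add_eq_zero_iff_eq_neg]

lemma swaps_mem {N : ℕ} (G : Submonoid (Equiv.Perm (Fin N))) (lo hi : ℕ)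
    (h : ∀ i : ℕ, ∀ hi' : i + 1 < N, lo ≤ i → i + 1 < hi →
      Equiv.swap (⟨i, by omega⟩ : Fin N) ⟨i + 1, hi'⟩ ∈ G) (a : ℕ) (ha : a < N) (hlo : lo ≤ a)
    (d : ℕ) (hd : a + 1 + d < N) (hhi : a + 1 + d < hi) :
    Equiv.swap (⟨a, ha⟩ : Fin N) ⟨a + 1 + d, hd⟩ ∈ G := by
  induction d with
  | zero => exact h a hd hlo hhi
  | succ d ih =>
    have h1 := ih (by omega) (by omega)
    have h2 := h (a + 1 + d) (by omega) (by omega) (by omega)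
    have := G.mul_mem (G.mul_mem h2 h1) h2
    convert this using 1
    ext x
    simp only [Equiv.Perm.mul_apply, Equiv.swap_apply_def, Fin.ext_iff]
    grind

lemma perm_mem {N : ℕ} (G : Submonoid (Equiv.Perm (Fin N))) (lo hi : ℕ)
    (h : ∀ i : ℕ, ∀ hi' : i + 1 < N, lo ≤ i → i + 1 < hi →
      Equiv.swap (⟨i, by omega⟩ : Fin N) ⟨i + 1, hi'⟩ ∈ G)
    (σ : Equiv.Perm (Fin N)) (hσ : ∀ i : Fin N, ¬ (lo ≤ (i : ℕ) ∧ (i : ℕ) < hi) → σ i = i) :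
    σ ∈ G := by
  have hsw : ∀ a b : Fin N, lo ≤ (a : ℕ) → (a : ℕ) < b → (b : ℕ) < hi → Equiv.swap a b ∈ G := by
    rintro ⟨a, ha⟩ ⟨b, hb⟩ h1 h2 h3
    simp only at h1 h2 h3
    obtain ⟨d, rfl⟩ : ∃ d, b = a + 1 + d := ⟨b - a - 1, by omega⟩
    exact swaps_mem G lo hi h a ha h1 d hb h3
  let p : Fin N → Prop := fun i => lo ≤ (i : ℕ) ∧ (i : ℕ) < hi
  have key : ∀ τ : Equiv.Perm {i // p i}, Equiv.Perm.ofSubtype τ ∈ G := by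
    intro τ
    induction τ using Equiv.Perm.swap_induction_on with
    | one => simp
    | swap_mul f x y hxy ih =>
      rw [map_mul]
      refine G.mul_mem ?_ ih
      rw [Equiv.Perm.ofSubtype_swap_eq]
      have hne : (x.1 : ℕ) ≠ y.1 := fun e => hxy (Subtype.ext (Fin.ext e))
      rcases lt_or_gt_of_ne hne with hl | hl
      · exact hsw _ _ x.2.1 hl y.2.2
      · rw [Equiv.swap_comm]; exact hsw _ _ y.2.1 hl x.2.2
  have hp : ∀ x, p (σ x) ↔ p x := by
    intro x
    by_cases hx : p x
    · refine iff_of_true ?_ hx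
      by_contra hc
      have := σ.injective (hσ _ hc)
      rw [this] at hc
      exact hc hx
    · rw [hσ x hx]
  have h2 := key (σ.subtypePerm hp)
  rwa [Equiv.Perm.ofSubtype_subtypePerm] at h2
  intro x hx
  by_contra hc
  exact hx (hσ x hc)

/-- elementary factors, indexed by natural numbers -/
noncomputable def rfac (hbar u : ℂ) (m k : ℕ) : Module.End ℂ (TPow n₁ n₂ V) :=
  if h : m < n₁ ∧ k < n₂ then
    Rab n₁ n₂ hbar (slotA n₁ n₂ ⟨m, h.1⟩) (slotB n₁ n₂ ⟨k, h.2⟩) (u + ((m + k : ℕ) : ℂ) * hbar)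
  else 1

lemma fusedF_eq (hbar u : ℂ) :
    (fusedF n₁ n₂ hbar u : Module.End ℂ (TPow n₁ n₂ V))
      = rprod (fun m => rprod (fun k => rfac n₁ n₂ hbar u m k) n₂) n₁ := by
  unfold fusedF fusePairs
  rw [flatMap_prod]
  apply finRange_rprod
  intro m
  rw [List.map_map]
  apply finRange_rprod
  intro k
  simp [rfac]

lemma fusedF_mem_right (hbar u : ℂ) (k : ℕ) (hk : k + 1 < n₂) :
    (fusedF n₁ n₂ hbar u : Module.End ℂ (TPow n₁ n₂ V)) ∈
      passH (symS n₁ n₂ (slotB n₁ n₂ ⟨k, by omega⟩) (slotB n₁ n₂ ⟨k + 1, hk⟩)) := by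
  rw [fusedF_eq]
  refine rprod_mem _ _ _ fun m hm => rprod_mem_pair _ _ k _ hk ?_ ?_
  · intro j hj h1 h2
    simp only [rfac, hm, hj, and_self, dite_true]
    apply Rab_mem <;> simp only [slotA, slotB, ne_eq, Fin.mk.injEq] <;> omega
  · have hk' : k < n₂ := by omega
    simp only [rfac, hm, hk, hk', and_self, dite_true]
    have := Rab_pair (V := V) n₁ n₂ hbar (u + ((m + k : ℕ) : ℂ) * hbar) (slotA n₁ n₂ ⟨m, hm⟩)
      (slotB n₁ n₂ ⟨k, hk'⟩) (slotB n₁ n₂ ⟨k + 1, hk⟩)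
      (by simp only [slotA, slotB, ne_eq, Fin.mk.injEq]; omega)
      (by simp only [slotA, slotB, ne_eq, Fin.mk.injEq]; omega)
      (by simp only [slotB, ne_eq, Fin.mk.injEq]; omega)
    convert this using 3
    push_cast; ring

lemma fusedF_mem_left (hbar u : ℂ) (m : ℕ) (hm : m + 1 < n₁) :
    (fusedF n₁ n₂ hbar u : Module.End ℂ (TPow n₁ n₂ V)) ∈
      passH (symS n₁ n₂ (slotA n₁ n₂ ⟨m, by omega⟩) (slotA n₁ n₂ ⟨m + 1, hm⟩)) := by
  have hm' : m < n₁ := by omega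
  rw [fusedF_eq]
  refine rprod_mem_pair _ _ m _ hm ?_ ?_
  · intro j hj h1 h2
    refine rprod_mem _ _ _ fun k hk => ?_
    simp only [rfac, hk, hj, and_self, dite_true]
    apply Rab_mem <;> simp only [slotA, slotB, ne_eq, Fin.mk.injEq] <;> omega
  · rw [rprod_mul]
    · refine rprod_mem _ _ _ fun k hk => ?_
      simp only [rfac, hm, hk, hm', and_self, dite_true]
      have := Rab_pair (V := V) n₁ n₂ hbar (u + ((m + k : ℕ) : ℂ) * hbar) (slotB n₁ n₂ ⟨k, hk⟩)
        (slotA n₁ n₂ ⟨m, hm'⟩) (slotA n₁ n₂ ⟨m + 1, hm⟩)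
        (by simp only [slotA, slotB, ne_eq, Fin.mk.injEq]; omega)
        (by simp only [slotA, slotB, ne_eq, Fin.mk.injEq]; omega)
        (by simp only [slotA, ne_eq, Fin.mk.injEq]; omega)
      rw [Rab_comm, Rab_comm n₁ n₂ hbar _ (slotA n₁ n₂ ⟨m, hm'⟩)]
      convert this using 3
      push_cast; ring
    · intro i hi j hj hij
      simp only [rfac, hm, hi, hj, hm', and_self, dite_true]
      apply Rab_commute <;> simp only [slotA, slotB, ne_eq, Fin.mk.injEq] <;> omega

lemma apply_zero_of_mem (S X : Module.End ℂ (TPow n₁ n₂ V)) (h : X ∈ passH S)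
    (w : TPow n₁ n₂ V) (hw : S w = 0) : S (X w) = 0 := by
  obtain ⟨X', hX⟩ := h
  have := congrArg (fun T => T w) hX
  simpa [hw] using this

end Perm

/-- the fused operator `F(u)` preserves the antisymmetric subspace
`W ≅ Λ^{n₁}V ⊗ Λ^{n₂}V` of `V^{⊗(n₁+n₂)}`. -/
theorem instanton_stmt10 (n₁ n₂ : ℕ) (hn₁ : 1 ≤ n₁) (hn₂ : 1 ≤ n₂)
    {V : Type*} [AddCommGroup V] [Module ℂ V] [FiniteDimensional ℂ V]
    (hbar u : ℂ) (w : TPow n₁ n₂ V) (hw : IsBiAntisym n₁ n₂ w) :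
    IsBiAntisym n₁ n₂ (fusedF n₁ n₂ hbar u w) := by
  constructor
  · intro σ hσ
    change σ ∈ anti n₁ n₂ (fusedF n₁ n₂ hbar u w)
    refine perm_mem _ 0 n₁ ?_ σ fun i hi => hσ i (by omega)
    intro i hi' _ hi
    have h0 : (⟨i, by omega⟩ : Fin (n₁ + n₂)) ≠ ⟨i + 1, hi'⟩ := by simp
    have hS := (swap_mem_anti n₁ n₂ w _ _ h0).1 (hw.1 _ (by
      intro j hj
      apply Equiv.swap_apply_of_ne_of_ne <;> simp only [ne_eq, Fin.ext_iff] <;> omega))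
    rw [swap_mem_anti n₁ n₂ _ _ _ h0]
    refine apply_zero_of_mem n₁ n₂ _ _ ?_ w hS
    have := fusedF_mem_left (V := V) n₁ n₂ hbar u (n₁ - 2 - i) (by omega)
    have ea : slotA n₁ n₂ ⟨n₁ - 2 - i, by omega⟩ = ⟨i + 1, hi'⟩ := by
      simp only [slotA, Fin.mk.injEq]; omega
    have eb : slotA n₁ n₂ ⟨n₁ - 2 - i + 1, by omega⟩ = ⟨i, by omega⟩ := by
      simp only [slotA, Fin.mk.injEq]; omega
    rw [ea, eb] at this
    unfold symS at this ⊢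
    rwa [Equiv.swap_comm]
  · intro σ hσ
    change σ ∈ anti n₁ n₂ (fusedF n₁ n₂ hbar u w)
    refine perm_mem _ n₁ (n₁ + n₂) ?_ σ fun i hi => hσ i (by omega)
    intro i hi' hlo hi
    have h0 : (⟨i, by omega⟩ : Fin (n₁ + n₂)) ≠ ⟨i + 1, hi'⟩ := by simp
    have hS := (swap_mem_anti n₁ n₂ w _ _ h0).1 (hw.2 _ (by
      intro j hj
      apply Equiv.swap_apply_of_ne_of_ne <;> simp only [ne_eq, Fin.ext_iff] <;> omega))
    rw [swap_mem_anti n₁ n₂ _ _ _ h0]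
    refine apply_zero_of_mem n₁ n₂ _ _ ?_ w hS
    have := fusedF_mem_right (V := V) n₁ n₂ hbar u (i - n₁) (by omega)
    have ea : slotB n₁ n₂ ⟨i - n₁, by omega⟩ = ⟨i, by omega⟩ := by
      simp only [slotB, Fin.mk.injEq]; omega
    have eb : slotB n₁ n₂ ⟨i - n₁ + 1, by omega⟩ = ⟨i + 1, hi'⟩ := by
      simp only [slotB, Fin.mk.injEq]; omega
    rwa [ea, eb] at this
end
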